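/- arXiv:2204.12436 — 2 statements merged into one kernel-verified Lean document; each statement's English description precedes it below -/
import Mathlib

section
/- Let m ≥ 4 and let N be a finite electorate with |N| ≥ 3 and |N| ∉ {4,6}. Every social decision scheme on N that satisfies PC-efficiency and the absolute winner property is PC-manipulable. -/
open scoped Classical
open Finset

noncomputable section

/-- A strict preference relation: a strict linear (total) order on `A`. -/
abbrev Pref (A : Type*) : Type _ := {r : A → A → Prop // IsStrictTotalOrder A r}

/-- A lottery over the finite set `A` of alternatives. -/
def Lottery (A : Type*) [Fintype A] : Type _ :=
  {p : A → ℝ // (∀ x, 0 ≤ p x) ∧ ∑ x : A, p x = 1}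

variable {A : Type*} [Fintype A]

/-- `∑_{x ≻ y} p(x) q(y)`. -/
def PCsum (r : Pref A) (p q : A → ℝ) : ℝ :=
  ∑ x : A, ∑ y : A, if r.val x y then p x * q y else 0

/-- Pairwise-comparison (weak) preference over lotteries: `p ≿^PC q`. -/
def PCge (r : Pref A) (p q : Lottery A) : Prop :=
  PCsum r q.val p.val ≤ PCsum r p.val q.val

/-- Pairwise-comparison strict preference over lotteries: `p ≻^PC q`. -/
def PCgt (r : Pref A) (p q : Lottery A) : Prop :=
  PCsum r q.val p.val < PCsum r p.val q.val

/-- An SDS on a fixed electorate `N` is PC-strategyproof if every voter always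
weakly PC-prefers the truthful outcome to any outcome from a unilateral deviation. -/
def PCStrategyproof {N : Type*} (f : (N → Pref A) → Lottery A) : Prop :=
  ∀ (i : N) (R R' : N → Pref A), (∀ j, j ≠ i → R j = R' j) → PCge (R i) (f R) (f R')

/-- `p` PC-dominates `q` in the profile `R`. -/
def PCDominates {I : Type*} (R : I → Pref A) (p q : Lottery A) : Prop :=
  (∀ i, PCge (R i) p q) ∧ (∃ i, PCgt (R i) p q)

/-- A lottery is PC-efficient in `R` if no lottery PC-dominates it. -/
def PCEfficientLottery {I : Type*} (R : I → Pref A) (p : Lottery A) : Prop :=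
  ¬ ∃ q : Lottery A, PCDominates R q p

/-- `x` is the top-ranked (most preferred) alternative of `r`. -/
def TopRanks (r : Pref A) (x : A) : Prop := ∀ y, y ≠ x → r.val x y

/-- `x` is the bottom-ranked (least preferred) alternative of `r`. -/
def BottomRanks (r : Pref A) (x : A) : Prop := ∀ y, y ≠ x → r.val y x

/-- `x` is an absolute winner in `R`: more than half of the voters rank `x` first. -/
def AbsoluteWinner {N : Type*} [Fintype N] (R : N → Pref A) (x : A) : Prop :=
  Fintype.card N < 2 * (univ.filter fun i => TopRanks (R i) x).card

/-- The absolute winner property on a fixed electorate. -/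
def AbsoluteWinnerProperty {N : Type*} [Fintype N] (f : (N → Pref A) → Lottery A) : Prop :=
  ∀ (R : N → Pref A) (x : A), AbsoluteWinner R x → (f R).val x = 1

/-! ### Rankings with prescribed top alternatives -/

/-- The position of `x` in the list `a, b, c, d`; alternatives outside the list get position `4`. -/
def rankPos (a b c d x : A) : ℕ :=
  if x = a then 0 else if x = b then 1 else if x = c then 2 else if x = d then 3 else 4

/-- The ranking `a ≻ b ≻ c ≻ d`, followed by the other alternatives in a fixed order. -/
def ranking (a b c d : A) : Pref A :=
  ⟨fun x y => rankPos a b c d x < rankPos a b c d y ∨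
      (rankPos a b c d x = rankPos a b c d y ∧ Fintype.equivFin A x < Fintype.equivFin A y), by
    refine { trichotomous := ?_, irrefl := ?_, trans := ?_ }
    · intro x y hxy hyx
      have : Fintype.equivFin A x = Fintype.equivFin A y := by
        rcases lt_trichotomy (Fintype.equivFin A x) (Fintype.equivFin A y) with h | h | h <;> grind
      exact (Fintype.equivFin A).injective this
    · intro x; simp
    · rintro x y z (h | ⟨h, h'⟩) (k | ⟨k, k'⟩)
      · exact Or.inl (h.trans k)
      · exact Or.inl (k ▸ h)
      · exact Or.inl (h ▸ k)
      · exact Or.inr ⟨h.trans k, h'.trans k'⟩⟩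

lemma ranking_iff (a b c d x y : A) : (ranking a b c d).val x y ↔
    rankPos a b c d x < rankPos a b c d y ∨
      (rankPos a b c d x = rankPos a b c d y ∧ Fintype.equivFin A x < Fintype.equivFin A y) :=
  Iff.rfl

lemma ranking_first (a b c d : A) : TopRanks (ranking a b c d) a := by
  intro y hy
  rw [ranking_iff]
  left
  simp only [rankPos, if_true, if_neg hy]
  split_ifs <;> norm_num

lemma ranking_val_iff {a b c d : A} (hn : [a, b, c, d].Nodup) (y : A) :
    ((ranking a b c d).val y a ↔ False) ∧ ((ranking a b c d).val y b ↔ y = a) ∧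
    ((ranking a b c d).val y c ↔ y = a ∨ y = b) ∧
    ((ranking a b c d).val y d ↔ y = a ∨ y = b ∨ y = c) ∧
    (y ∉ [a, b, c, d] → (ranking a b c d).val a y ∧ (ranking a b c d).val b y ∧
      (ranking a b c d).val c y ∧ (ranking a b c d).val d y) := by
  simp only [ranking_iff, rankPos]
  simp only [List.nodup_cons, List.mem_cons, List.not_mem_nil, or_false] at hn ⊢
  grind

lemma pref_asymm {B : Type*} (r : Pref B) {x y : B} (h : r.val x y) : ¬ r.val y x := by
  have := r.2
  exact asymm_of r.val h

lemma pref_trichotomy {B : Type*} (r : Pref B) {x y : B} (hxy : x ≠ y) : r.val x y ∨ r.val y x := by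
  have := r.2
  rcases trichotomous_of r.val x y with h | h | h
  · exact Or.inl h
  · exact absurd h hxy
  · exact Or.inr h

/-! ### Pairwise comparison scores -/

/-- The margin `1`, `-1` or `0` of `x` over `y`. -/
def margin {B : Type*} (r : Pref B) (x y : B) : ℝ :=
  (if r.val x y then 1 else 0) - (if r.val y x then 1 else 0)

/-- The PC score of the alternative `x` against the lottery `q`. -/
def pcScore (r : Pref A) (q : A → ℝ) (x : A) : ℝ := ∑ y, margin r x y * q y

lemma pcsum_sub (r : Pref A) (p q : A → ℝ) :
    PCsum r p q - PCsum r q p = ∑ x, p x * pcScore r q x := by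
  have h : PCsum r q p = ∑ x, ∑ y, if r.val y x then p x * q y else 0 := by
    unfold PCsum
    rw [sum_comm]
    refine sum_congr rfl fun x _ => sum_congr rfl fun y _ => ?_
    split_ifs <;> ring
  rw [h]
  unfold PCsum pcScore margin
  rw [← sum_sub_distrib]
  refine sum_congr rfl fun x _ => ?_
  rw [← sum_sub_distrib, mul_sum]
  refine sum_congr rfl fun y _ => ?_
  split_ifs <;> ring

lemma margin_le_of_pref {B : Type*} (r : Pref B) {x y : B} (h : r.val x y) (w : B) :
    margin r y w ≤ margin r x w := by
  have hr := r.2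
  have hyx := pref_asymm r h
  unfold margin
  by_cases h1 : r.val y w
  · have h2 : r.val x w := trans_of r.val h h1
    have h3 := pref_asymm r h1
    have h4 := pref_asymm r h2
    simp [h1, h2, h3, h4]
  · by_cases h2 : r.val w x
    · have h3 : r.val w y := trans_of r.val h2 h
      have h4 := pref_asymm r h2
      simp [h1, h2, h3, h4]
    · simp only [h1, h2, if_false]
      split_ifs <;> norm_num

lemma add_le_pcScore (r : Pref A) {x y : A} (h : r.val x y) {q : A → ℝ} (hq : ∀ z, 0 ≤ q z) :
    pcScore r q y + q y ≤ pcScore r q x := by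
  have hyx := pref_asymm r h
  have hm : ∀ w, margin r y w * q w + (if w = y then q y else 0) ≤ margin r x w * q w := by
    intro w
    by_cases hw : w = y
    · subst hw
      have : margin r w w = 0 := by unfold margin; ring
      have : margin r x w = 1 := by unfold margin; simp [h, hyx]
      simp [*]
    · simpa [hw] using mul_le_mul_of_nonneg_right (margin_le_of_pref r h w) (hq w)
  have := sum_le_sum fun w (_ : w ∈ (univ : Finset A)) => hm w
  rw [sum_add_distrib] at this
  simpa [pcScore] using this

lemma PCgt_iff (r : Pref A) (p q : Lottery A) :
    PCgt r p q ↔ 0 < ∑ x, p.val x * pcScore r q.val x := by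
  rw [← pcsum_sub, sub_pos]; rfl

lemma PCge_iff (r : Pref A) (p q : Lottery A) :
    PCge r p q ↔ 0 ≤ ∑ x, p.val x * pcScore r q.val x := by
  rw [← pcsum_sub, sub_nonneg]; rfl

lemma sum_mul_pcScore_self (r : Pref A) (p : A → ℝ) : ∑ x, p x * pcScore r p x = 0 := by
  rw [← pcsum_sub, sub_self]

/-- An efficient lottery puts no weight on Pareto-dominated alternatives. -/
lemma PCEfficientLottery.eq_zero_of_pareto {N : Type*} [Nonempty N] {R : N → Pref A}
    {p : Lottery A} (hp : PCEfficientLottery R p) {x y : A} (h : ∀ i, (R i).val x y) :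
    p.val y = 0 := by
  by_contra hy
  have hpos : 0 < p.val y := lt_of_le_of_ne (p.2.1 y) (Ne.symm hy)
  obtain ⟨i₀⟩ := ‹Nonempty N›
  have hxy : x ≠ y := by
    rintro rfl
    exact pref_asymm _ (h i₀) (h i₀)
  let q : Lottery A := ⟨fun z => p.val z + p.val y * ((if z = x then 1 else 0) -
      (if z = y then 1 else 0)), by
    constructor
    · intro z
      by_cases hz : z = y
      · subst hz; simp [hxy.symm]
      · simp only [hz, if_false, sub_zero]
        have := p.2.1 z
        split_ifs <;> simp <;> linarith
    · rw [sum_add_distrib, p.2.2, ← mul_sum, sum_sub_distrib]; simp⟩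
  have key : ∀ i, PCgt (R i) q p := by
    intro i
    rw [PCgt_iff]
    have e : ∑ z, q.val z * pcScore (R i) p.val z =
        p.val y * (pcScore (R i) p.val x - pcScore (R i) p.val y) := by
      have e1 : ∀ z, q.val z * pcScore (R i) p.val z = p.val z * pcScore (R i) p.val z +
          p.val y * ((if z = x then pcScore (R i) p.val z else 0) -
            (if z = y then pcScore (R i) p.val z else 0)) := by
        intro z
        simp only [q]
        split_ifs <;> ring
      simp only [e1]
      rw [sum_add_distrib, sum_mul_pcScore_self, ← mul_sum, sum_sub_distrib]
      simp
    rw [e]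
    have := add_le_pcScore (R i) (h i) p.2.1
    apply mul_pos hpos
    linarith
  exact hp ⟨q, fun i => (key i).le, i₀, key i₀⟩

/-! ### Degenerate lotteries -/

/-- The lottery that selects `x` with certainty. -/
def Lottery.point (x : A) : Lottery A :=
  ⟨fun y => if y = x then 1 else 0, fun y => by dsimp only; split_ifs <;> norm_num, by simp⟩

lemma Lottery.eq_point {p : Lottery A} {x : A} (h : p.val x = 1) : p = Lottery.point x := by
  apply Subtype.ext
  funext y
  have hs := p.2.2
  rw [← add_sum_erase _ _ (mem_univ x), h] at hs
  have h0 : ∑ z ∈ univ.erase x, p.val z = 0 := by linarith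
  rw [sum_eq_zero_iff_of_nonneg fun z _ => p.2.1 z] at h0
  by_cases hy : y = x
  · subst hy; simp [point, h]
  · simpa [point, hy] using h0 y (by simp [hy])

lemma pcScore_eq_of_upper (r : Pref A) (p : Lottery A) {x : A} {U : Finset A}
    (hU : ∀ y, r.val y x ↔ y ∈ U) :
    pcScore r p.val x = 1 - p.val x - 2 * ∑ y ∈ U, p.val y := by
  have hm : ∀ y, margin r x y * p.val y = p.val y - (if y = x then p.val y else 0) -
      2 * (if y ∈ U then p.val y else 0) := by
    intro y
    unfold margin
    by_cases hy : y = x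
    · subst hy
      have : ¬ r.val y y := fun h => pref_asymm r h h
      simp [← hU, this]
    · by_cases hyU : r.val y x
      · have h1 := pref_asymm r hyU
        have h2 := (hU y).1 hyU
        simp [hyU, h1, h2, hy]; ring
      · have h1 := (pref_trichotomy r hy).resolve_left hyU
        have h2 := (hU y).not.1 hyU
        simp [hyU, h1, h2, hy]
  unfold pcScore
  simp only [hm]
  rw [sum_sub_distrib, sum_sub_distrib, ← mul_sum, p.2.2]
  simp

lemma PCge_point_iff (r : Pref A) (p : Lottery A) {x : A} {U : Finset A}
    (hU : ∀ y, r.val y x ↔ y ∈ U) :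
    PCge r (Lottery.point x) p ↔ 2 * ∑ y ∈ U, p.val y ≤ 1 - p.val x := by
  rw [PCge_iff]
  simp [Lottery.point, pcScore_eq_of_upper r p hU]

lemma PCgt_point_iff (r : Pref A) (p : Lottery A) {x : A} {U : Finset A}
    (hU : ∀ y, r.val y x ↔ y ∈ U) :
    PCgt r (Lottery.point x) p ↔ 2 * ∑ y ∈ U, p.val y < 1 - p.val x := by
  rw [PCgt_iff]
  simp [Lottery.point, pcScore_eq_of_upper r p hU]

lemma PCge_of_point_iff (r : Pref A) (p : Lottery A) {x : A} {U : Finset A}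
    (hU : ∀ y, r.val y x ↔ y ∈ U) :
    PCge r p (Lottery.point x) ↔ 1 - p.val x ≤ 2 * ∑ y ∈ U, p.val y := by
  rw [← not_lt, ← PCgt_point_iff r p hU]
  unfold PCge PCgt
  rw [not_lt]

lemma TopRanks.upper {B : Type*} {r : Pref B} {x : B} (h : TopRanks r x) (y : B) :
    r.val y x ↔ y ∈ (∅ : Finset B) := by
  simp only [notMem_empty, iff_false]
  intro hy
  by_cases e : y = x
  · subst e; exact pref_asymm r hy hy
  · exact pref_asymm r hy (h y e)

/-! ### Lotteries with small support -/

lemma sum_mul_pcScore_of_support (r : Pref A) {p q : Lottery A} {S : Finset A}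
    (hp : ∀ x ∉ S, p.val x = 0) (hq : ∀ x ∉ S, q.val x = 0) :
    ∑ x, p.val x * pcScore r q.val x =
      ∑ x ∈ S, p.val x * ∑ y ∈ S, margin r x y * q.val y := by
  rw [← sum_subset (subset_univ S) fun x _ hx => by rw [hp x hx, zero_mul]]
  refine sum_congr rfl fun x _ => ?_
  rw [pcScore, ← sum_subset (subset_univ S) fun y _ hy => by rw [hq y hy, mul_zero]]

lemma Lottery.sum_of_support {p : Lottery A} {S : Finset A} (hp : ∀ x ∉ S, p.val x = 0) :
    ∑ x ∈ S, p.val x = 1 :=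
  (sum_subset (subset_univ S) fun x _ hx => hp x hx).trans p.2.2

lemma Lottery.sum_le_one (p : Lottery A) (S : Finset A) : ∑ x ∈ S, p.val x ≤ 1 :=
  (sum_le_sum_of_subset_of_nonneg (subset_univ S) fun x _ _ => p.2.1 x).trans_eq p.2.2

lemma Lottery.add_eq_one {p : Lottery A} {a x : A} (hax : a ≠ x)
    (hp : ∀ y, y ≠ a → y ≠ x → p.val y = 0) : p.val a + p.val x = 1 := by
  rw [← sum_pair hax (f := p.val)]
  exact Lottery.sum_of_support (by grind)

lemma PCge_iff_of_pair {r : Pref A} {p q : Lottery A} {a x : A} (hr : r.val a x)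
    (hp : ∀ y, y ≠ a → y ≠ x → p.val y = 0) (hq : ∀ y, y ≠ a → y ≠ x → q.val y = 0) :
    PCge r p q ↔ q.val a ≤ p.val a := by
  have hxa := pref_asymm r hr
  have hax : a ≠ x := by rintro rfl; exact hxa hr
  have h0 : ∀ y, ¬ r.val y y := fun y h => pref_asymm r h h
  rw [PCge_iff, sum_mul_pcScore_of_support r (S := {a, x}) (by grind) (by grind)]
  have hp1 := Lottery.add_eq_one hax hp
  have hq1 := Lottery.add_eq_one hax hq
  rw [← sub_nonneg (a := p.val a)]
  simp only [sum_pair hax, margin, hr, hxa, h0, if_true, if_false,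
    eq_sub_iff_add_eq'.2 hq1, eq_sub_iff_add_eq'.2 hp1]
  ring_nf

lemma ranking_val_of_mem {a b c d x y : A} (hx : x ∈ [a, b, c, d]) (hy : y ∉ [a, b, c, d]) :
    (ranking a b c d).val x y := by
  rw [ranking_iff]
  left
  simp only [List.mem_cons, List.not_mem_nil, or_false] at hx hy
  simp only [rankPos]
  grind

lemma Lottery.sum_eq_one {p : Lottery A} {a b c d : A} (hn : [a, b, c, d].Nodup)
    (hp : ∀ y ∉ [a, b, c, d], p.val y = 0) : p.val a + p.val b + p.val c + p.val d = 1 := by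
  have h : ∑ y ∈ ({a, b, c, d} : Finset A), p.val y = 1 :=
    Lottery.sum_of_support fun y hy => hp y (by simpa using hy)
  simp only [List.nodup_cons, List.mem_cons, List.not_mem_nil, or_false, not_or] at hn
  rw [sum_insert (by simp; tauto), sum_insert (by simp; tauto), sum_insert (by simp; tauto),
    sum_singleton] at h
  linarith

/-- The advantage of `p` over `q` for the ranking `a ≻ b ≻ c ≻ d`. -/
def rankGain (a b c d : A) (p q : A → ℝ) : ℝ :=
  p a * (q b + q c + q d) + p b * (q c + q d - q a) + p c * (q d - q a - q b)
    - p d * (q a + q b + q c)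

lemma sum_mul_pcScore_ranking {p q : Lottery A} {a b c d : A} (hn : [a, b, c, d].Nodup)
    (hp : ∀ y ∉ [a, b, c, d], p.val y = 0) (hq : ∀ y ∉ [a, b, c, d], q.val y = 0) :
    ∑ x, p.val x * pcScore (ranking a b c d) q.val x = rankGain a b c d p.val q.val := by
  have hr := ranking_val_iff hn
  rw [sum_mul_pcScore_of_support _ (S := {a, b, c, d}) (fun y hy => hp y (by simpa using hy))
    (fun y hy => hq y (by simpa using hy))]
  simp only [List.nodup_cons, List.mem_cons, List.not_mem_nil, or_false, not_or] at hn
  obtain ⟨⟨hab, hac, had⟩, ⟨hbc, hbd⟩, hcd, -⟩ := hn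
  have hsum : ∀ g : A → ℝ, ∑ y ∈ ({a, b, c, d} : Finset A), g y = g a + g b + g c + g d := by
    intro g
    rw [sum_insert (by simp; tauto), sum_insert (by simp; tauto), sum_insert (by simp; tauto),
      sum_singleton]
    ring
  simp only [hsum, margin, (hr _).1, (hr _).2.1, (hr _).2.2.1, (hr _).2.2.2.1, hab, hac, hbc,
    Ne.symm hab, Ne.symm hac, Ne.symm had, Ne.symm hbc, Ne.symm hbd, Ne.symm hcd, rankGain,
    or_false, or_true, if_true, if_false]
  ring

lemma PCge_ranking_iff {p q : Lottery A} {a b c d x y z w : A} (hn : [a, b, c, d].Nodup)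
    (hperm : [x, y, z, w].Perm [a, b, c, d])
    (hp : ∀ y ∉ [a, b, c, d], p.val y = 0) (hq : ∀ y ∉ [a, b, c, d], q.val y = 0) :
    PCge (ranking x y z w) p q ↔ 0 ≤ rankGain x y z w p.val q.val := by
  rw [PCge_iff, sum_mul_pcScore_ranking (hperm.nodup_iff.2 hn)] <;> simpa only [hperm.mem_iff]

lemma PCgt_ranking_iff {p q : Lottery A} {a b c d x y z w : A} (hn : [a, b, c, d].Nodup)
    (hperm : [x, y, z, w].Perm [a, b, c, d])
    (hp : ∀ y ∉ [a, b, c, d], p.val y = 0) (hq : ∀ y ∉ [a, b, c, d], q.val y = 0) :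
    PCgt (ranking x y z w) p q ↔ 0 < rankGain x y z w p.val q.val := by
  rw [PCgt_iff, sum_mul_pcScore_ranking (hperm.nodup_iff.2 hn)] <;> simpa only [hperm.mem_iff]

lemma exists_lottery {a b c d : A} (hn : [a, b, c, d].Nodup) {wa wb wc wd : ℝ} (ha : 0 ≤ wa)
    (hb : 0 ≤ wb) (hc : 0 ≤ wc) (hd : 0 ≤ wd) (h : wa + wb + wc + wd = 1) :
    ∃ q : Lottery A, q.val a = wa ∧ q.val b = wb ∧ q.val c = wc ∧ q.val d = wd ∧
      ∀ y ∉ [a, b, c, d], q.val y = 0 := by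
  simp only [List.nodup_cons, List.mem_cons, List.not_mem_nil, or_false, not_or] at hn
  obtain ⟨⟨hab, hac, had⟩, ⟨hbc, hbd⟩, hcd, -⟩ := hn
  refine ⟨⟨fun y => (if y = a then wa else 0) + (if y = b then wb else 0) +
    (if y = c then wc else 0) + (if y = d then wd else 0), fun y => ?_, ?_⟩, ?_⟩
  · dsimp only
    split_ifs <;> linarith
  · simp [sum_add_distrib, h]
  · simp [hab, hac, had, hbc, hbd, hcd, Ne.symm hab, Ne.symm hac, Ne.symm had, Ne.symm hbc,
      Ne.symm hbd, Ne.symm hcd]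
    grind

/-! ### Consequences of strategyproofness -/

section SDS

variable {N : Type*} {f : (N → Pref A) → Lottery A}

lemma PCStrategyproof.update (hsp : PCStrategyproof f) (R : N → Pref A) (i : N) (r : Pref A) :
    PCge (R i) (f R) (f (Function.update R i r)) :=
  hsp i _ _ fun j hj => by rw [Function.update_of_ne hj]

lemma PCStrategyproof.update' (hsp : PCStrategyproof f) (R : N → Pref A) (i : N) (r : Pref A) :
    PCge r (f (Function.update R i r)) (f R) := by
  have := hsp i (Function.update R i r) R fun j hj => by rw [Function.update_of_ne hj]
  rwa [Function.update_self] at this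

lemma PCStrategyproof.update_eq_of_pair (hsp : PCStrategyproof f) {a x : A} (hax : a ≠ x)
    {R : N → Pref A} {i : N} {r : Pref A} (hr : (R i).val a x ↔ r.val a x)
    (h : ∀ y, y ≠ a → y ≠ x → (f R).val y = 0)
    (h' : ∀ y, y ≠ a → y ≠ x → (f (Function.update R i r)).val y = 0) :
    (f (Function.update R i r)).val a = (f R).val a := by
  have h1 := hsp.update R i r
  have h2 := hsp.update' R i r
  by_cases hi : r.val a x
  · rw [PCge_iff_of_pair (hr.2 hi) h h'] at h1
    rw [PCge_iff_of_pair hi h' h] at h2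
    exact le_antisymm h1 h2
  · have hi' := (pref_trichotomy r hax).resolve_left hi
    have hi'' := (pref_trichotomy (R i) hax).resolve_left (hr.not.2 hi)
    rw [PCge_iff_of_pair hi'' (fun y hy hy' => h y hy' hy) (fun y hy hy' => h' y hy' hy)] at h1
    rw [PCge_iff_of_pair hi' (fun y hy hy' => h' y hy' hy) (fun y hy hy' => h y hy' hy)] at h2
    have e := Lottery.add_eq_one hax h
    have e' := Lottery.add_eq_one hax h'
    linarith

/-- On a product domain where only `a` and `x` receive positive probability and every voter has a
fixed comparison of `a` and `x`, a strategyproof SDS is constant. -/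
lemma PCStrategyproof.eq_of_pair [Fintype N] (hsp : PCStrategyproof f) {a x : A} (hax : a ≠ x)
    {C : N → Pref A → Prop}
    (hC : ∀ R : N → Pref A, (∀ i, C i (R i)) → ∀ y, y ≠ a → y ≠ x → (f R).val y = 0)
    (hagree : ∀ i r r', C i r → C i r' → (r.val a x ↔ r'.val a x)) {R R' : N → Pref A}
    (hR : ∀ i, C i (R i)) (hR' : ∀ i, C i (R' i)) : (f R).val a = (f R').val a := by
  have hmem : ∀ S : Finset N, ∀ i, C i (S.piecewise R R' i) := by
    intro S i
    by_cases hi : i ∈ S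
    · rw [piecewise_eq_of_mem _ _ _ hi]; exact hR i
    · rw [piecewise_eq_of_notMem _ _ _ hi]; exact hR' i
  have key : ∀ S : Finset N, (f (S.piecewise R R')).val a = (f R').val a := by
    intro S
    induction S using Finset.induction_on with
    | empty => rw [piecewise_empty]
    | insert j S hj ih =>
      have hins := hC _ (hmem (insert j S))
      rw [piecewise_insert] at hins ⊢
      rw [hsp.update_eq_of_pair hax (hagree j _ _ (hmem S j) (hR j)) (hC _ (hmem S)) hins, ih]
  rw [← key univ, piecewise_univ]

lemma AbsoluteWinnerProperty.eq_one [Fintype N] (hawp : AbsoluteWinnerProperty f)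
    {R : N → Pref A} {x : A} {Q : Finset N} (hQ : 2 * Q.card < Fintype.card N)
    (h : ∀ i ∉ Q, TopRanks (R i) x) : (f R).val x = 1 := by
  apply hawp
  unfold AbsoluteWinner
  have h1 : Qᶜ ⊆ univ.filter fun i => TopRanks (R i) x := by
    intro i hi
    simpa using h i (by simpa using hi)
  have h2 := card_le_card h1
  have h3 := card_add_card_compl Q
  omega

/-- If the voters not ranking `x` first split into two minorities with disjoint sets of
alternatives above `x`, then `x` is chosen with certainty. -/
lemma eq_one_of_two_minorities [Fintype N] (hsp : PCStrategyproof f)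
    (heff : ∀ R : N → Pref A, PCEfficientLottery R (f R)) (hawp : AbsoluteWinnerProperty f)
    {x : A} {U V : Finset A} (hUV : Disjoint U V) (hxU : x ∉ U) (hxV : x ∉ V)
    (R : N → Pref A) (P Q : Finset N) (hP : 2 * P.card < Fintype.card N)
    (hQ : 2 * Q.card < Fintype.card N)
    (hR : ∀ i, (i ∈ P ∧ ∀ y, (R i).val y x ↔ y ∈ U) ∨ (i ∈ Q ∧ ∀ y, (R i).val y x ↔ y ∈ V) ∨
      TopRanks (R i) x)
    (htop : ∃ i, TopRanks (R i) x) : (f R).val x = 1 := by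
  induction hk : P.card + Q.card using Nat.strong_induction_on generalizing P Q R with
  | _ k ih =>
  obtain ⟨i₀, hi₀⟩ := htop
  have lift : ∀ i, ∃ j, TopRanks (Function.update R i (ranking x x x x) j) x := fun i =>
    ⟨i, by rw [Function.update_self]; exact ranking_first x x x x⟩
  by_cases hPU : ∃ i ∈ P, ∀ y, (R i).val y x ↔ y ∈ U
  · by_cases hQV : ∃ j ∈ Q, ∀ y, (R j).val y x ↔ y ∈ V
    · obtain ⟨i, hi, hiU⟩ := hPU
      obtain ⟨j, hj, hjV⟩ := hQV
      have ci := card_erase_add_one hi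
      have cj := card_erase_add_one hj
      have h1 : (f (Function.update R i (ranking x x x x))).val x = 1 := by
        refine ih _ ?_ _ (P.erase i) Q (by omega) hQ ?_ (lift i) rfl
        · omega
        · intro l
          by_cases hl : l = i
          · subst hl
            rw [Function.update_self]
            exact Or.inr (Or.inr (ranking_first x x x x))
          · rw [Function.update_of_ne hl]
            simpa [hl] using hR l
      have h2 : (f (Function.update R j (ranking x x x x))).val x = 1 := by
        refine ih _ ?_ _ P (Q.erase j) hP (by omega) ?_ (lift j) rfl
        · omega
        · intro l
          by_cases hl : l = j
          · subst hl
            rw [Function.update_self]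
            exact Or.inr (Or.inr (ranking_first x x x x))
          · rw [Function.update_of_ne hl]
            simpa [hl] using hR l
      have g1 := hsp.update R i (ranking x x x x)
      have g2 := hsp.update R j (ranking x x x x)
      rw [Lottery.eq_point h1, PCge_of_point_iff _ _ hiU] at g1
      rw [Lottery.eq_point h2, PCge_of_point_iff _ _ hjV] at g2
      have hsum : ∑ y ∈ U, (f R).val y + ∑ y ∈ V, (f R).val y ≤ 1 - (f R).val x := by
        have hx : x ∉ U ∪ V := by simp [hxU, hxV]
        have := (f R).sum_le_one (insert x (U ∪ V))
        rw [sum_insert hx, sum_union hUV] at this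
        linarith
      by_contra hne
      have hle : (f R).val x ≤ 1 := by simpa using (f R).sum_le_one {x}
      have hlt : (f R).val x < 1 := lt_of_le_of_ne hle hne
      refine heff R ⟨Lottery.point x, fun l => ?_, i₀, ?_⟩
      · rcases hR l with ⟨-, h⟩ | ⟨-, h⟩ | h
        · rw [PCge_point_iff _ _ h]; linarith
        · rw [PCge_point_iff _ _ h]; linarith
        · rw [PCge_point_iff _ _ h.upper, sum_empty]; linarith
      · rw [PCgt_point_iff _ _ hi₀.upper, sum_empty]; linarith
    · exact hawp.eq_one hP fun i hi => by grind
  · exact hawp.eq_one hQ fun i hi => by grind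

/-! ### Efficiency on four alternatives -/

lemma PCEfficientLottery.eq_zero_of_notMem [Nonempty N] {R : N → Pref A} {p : Lottery A}
    (hp : PCEfficientLottery R p) {a b c d : A}
    (hR : ∀ i, ∃ x y z w, R i = ranking x y z w ∧ [x, y, z, w].Perm [a, b, c, d]) :
    ∀ y ∉ [a, b, c, d], p.val y = 0 := by
  intro y hy
  refine hp.eq_zero_of_pareto (x := a) fun i => ?_
  obtain ⟨x', y', z', w', h, hperm⟩ := hR i
  rw [h]
  exact ranking_val_of_mem (hperm.mem_iff.2 (by simp)) (by rwa [hperm.mem_iff])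

/-- If all voters report `abcd`, `bcda` or `dcba` and the last two alternatives of `abcd` are not
more likely than its first one, then efficiency rules them out. -/
lemma PCEfficientLottery.eq_zero_of_bcda {R : N → Pref A} {p : Lottery A}
    (hp : PCEfficientLottery R p) {a b c d : A} (hn : [a, b, c, d].Nodup)
    (h0 : ∀ y ∉ [a, b, c, d], p.val y = 0)
    (hR : ∀ i, R i = ranking a b c d ∨ R i = ranking b c d a ∨ R i = ranking d c b a)
    (hex : ∃ i, R i = ranking b c d a) (hle : p.val c + p.val d ≤ p.val a) :
    p.val c = 0 ∧ p.val d = 0 := by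
  have ha := p.2.1 a
  have hb := p.2.1 b
  have hc := p.2.1 c
  have hd := p.2.1 d
  have h1 := Lottery.sum_eq_one hn h0
  by_contra hne
  have hs : 0 < p.val c + p.val d := by
    rcases hc.lt_or_eq with h | h
    · linarith
    · rcases hd.lt_or_eq with h' | h'
      · linarith
      · exact absurd ⟨h.symm, h'.symm⟩ hne
  have hea : p.val a = 1 - p.val b - p.val c - p.val d := by linarith
  obtain ⟨q, qa, qb, qc, qd, q0⟩ := exists_lottery hn
    (wa := p.val a * (1 - (p.val c + p.val d + p.val b) * (p.val c + p.val d)))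
    (wb := p.val b + (1 + p.val b) * p.val a * (p.val c + p.val d))
    (wc := p.val c * (1 - (p.val a + p.val b) * p.val a))
    (wd := p.val d * (1 - (p.val a + p.val b) * p.val a))
    (mul_nonneg ha (by nlinarith)) (by positivity) (mul_nonneg hc (by nlinarith))
    (mul_nonneg hd (by nlinarith)) (by rw [hea]; ring)
  have gain : rankGain b c d a q.val p.val =
      2 * p.val a * (p.val c + p.val d) * (p.val b + (p.val c + p.val d)) := by
    rw [rankGain, qa, qb, qc, qd, hea]; ring
  refine hp ⟨q, fun i => ?_, ?_⟩
  · rcases hR i with h | h | h <;> rw [h, PCge_ranking_iff hn (by grind) q0 h0]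
    · apply le_of_eq
      rw [rankGain, qa, qb, qc, qd, hea]; ring
    · rw [gain]; positivity
    · apply le_of_eq
      rw [rankGain, qa, qb, qc, qd, hea]; ring
  · obtain ⟨i, hi⟩ := hex
    refine ⟨i, ?_⟩
    have ha' : 0 < p.val a := by linarith
    rw [hi, PCgt_ranking_iff hn (by grind) q0 h0, gain]
    positivity

/-- If all voters report `abcd`, `dabc` or `dcba`, then efficiency rules out `b` and `c`. -/
lemma PCEfficientLottery.eq_zero_of_dabc {R : N → Pref A} {p : Lottery A}
    (hp : PCEfficientLottery R p) {a b c d : A} (hn : [a, b, c, d].Nodup)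
    (h0 : ∀ y ∉ [a, b, c, d], p.val y = 0)
    (hR : ∀ i, R i = ranking a b c d ∨ R i = ranking d a b c ∨ R i = ranking d c b a)
    (hex : ∃ i, R i = ranking d a b c) : p.val b = 0 ∧ p.val c = 0 := by
  have ha := p.2.1 a
  have hb := p.2.1 b
  have hc := p.2.1 c
  have hd := p.2.1 d
  have h1 := Lottery.sum_eq_one hn h0
  by_contra hne
  have hs : 0 < p.val b + p.val c := by
    rcases hb.lt_or_eq with h | h
    · linarith
    · rcases hc.lt_or_eq with h' | h'
      · linarith
      · exact absurd ⟨h.symm, h'.symm⟩ hne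
  have hed : p.val d = 1 - p.val a - p.val b - p.val c := by linarith
  obtain ⟨q, qa, qb, qc, qd, q0⟩ := exists_lottery hn
    (wa := p.val a + (p.val b + p.val c + p.val d) * (p.val b + p.val c) / 2)
    (wb := p.val b * (1 - (p.val b + p.val c)) / 2)
    (wc := p.val c * (1 - (p.val b + p.val c)) / 2)
    (wd := p.val d + (p.val b + p.val c + p.val a) * (p.val b + p.val c) / 2)
    (by positivity) (div_nonneg (mul_nonneg hb (by linarith)) zero_le_two)
    (div_nonneg (mul_nonneg hc (by linarith)) zero_le_two) (by positivity) (by rw [hed]; ring)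
  have gain : rankGain d a b c q.val p.val =
      (p.val b + p.val c) * (p.val a + (p.val b + p.val c)) := by
    rw [rankGain, qa, qb, qc, qd, hed]; ring
  refine hp ⟨q, fun i => ?_, ?_⟩
  · rcases hR i with h | h | h <;> rw [h, PCge_ranking_iff hn (by grind) q0 h0]
    · apply le_of_eq
      rw [rankGain, qa, qb, qc, qd, hed]; ring
    · rw [gain]; positivity
    · apply le_of_eq
      rw [rankGain, qa, qb, qc, qd, hed]; ring
  · obtain ⟨i, hi⟩ := hex
    refine ⟨i, ?_⟩
    rw [hi, PCgt_ranking_iff hn (by grind) q0 h0, gain]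
    positivity

/-- If all voters report `abcd`, `cabd`, `dcab` or `dcba` and `d` is not more likely than `a` and `b`
together, then efficiency rules out `b` and `d`. -/
lemma PCEfficientLottery.eq_zero_of_cabd {R : N → Pref A} {p : Lottery A}
    (hp : PCEfficientLottery R p) {a b c d : A} (hn : [a, b, c, d].Nodup)
    (h0 : ∀ y ∉ [a, b, c, d], p.val y = 0)
    (hR : ∀ i, R i = ranking a b c d ∨ R i = ranking c a b d ∨ R i = ranking d c a b ∨
      R i = ranking d c b a)
    (hex : ∃ i, R i = ranking c a b d) (hle : p.val d ≤ p.val a + p.val b) :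
    p.val b = 0 ∧ p.val d = 0 := by
  have ha := p.2.1 a
  have hb := p.2.1 b
  have hc := p.2.1 c
  have hd := p.2.1 d
  have h1 := Lottery.sum_eq_one hn h0
  obtain ⟨i, hi⟩ := hex
  have hd0 : p.val d = 0 := by
    by_contra hne
    have hd' : 0 < p.val d := lt_of_le_of_ne hd (Ne.symm hne)
    have hu : 0 < p.val a + p.val b := by linarith
    have hec : p.val c = 1 - p.val a - p.val b - p.val d := by linarith
    obtain ⟨q, qa, qb, qc, qd, q0⟩ := exists_lottery hn
      (wa := p.val a * (1 - (p.val c + p.val d) * p.val d))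
      (wb := p.val b * (1 - (p.val c + p.val d) * p.val d))
      (wc := p.val c + (1 + p.val c) * (p.val a + p.val b) * p.val d)
      (wd := p.val d * (1 - (p.val c + (p.val a + p.val b)) * (p.val a + p.val b)))
      (mul_nonneg ha (by nlinarith)) (mul_nonneg hb (by nlinarith)) (by positivity)
      (mul_nonneg hd (by nlinarith)) (by rw [hec]; ring)
    have gain : rankGain c a b d q.val p.val =
        2 * (p.val a + p.val b) * p.val d * (p.val c + (p.val a + p.val b)) := by
      rw [rankGain, qa, qb, qc, qd, hec]; ring
    refine hp ⟨q, fun i => ?_, i, ?_⟩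
    · rcases hR i with h | h | h | h <;> rw [h, PCge_ranking_iff hn (by grind) q0 h0]
      · apply le_of_eq
        rw [rankGain, qa, qb, qc, qd, hec]; ring
      · rw [gain]; positivity
      · apply le_of_eq
        rw [rankGain, qa, qb, qc, qd, hec]; ring
      · apply le_of_eq
        rw [rankGain, qa, qb, qc, qd, hec]; ring
    · rw [hi, PCgt_ranking_iff hn (by grind) q0 h0, gain]
      positivity
  refine ⟨?_, hd0⟩
  by_contra hne
  have hb' : 0 < p.val b := lt_of_le_of_ne hb (Ne.symm hne)
  have hec : p.val c = 1 - p.val a - p.val b := by linarith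
  obtain ⟨q, qa, qb, qc, qd, q0⟩ := exists_lottery hn
    (wa := p.val a + (p.val b + p.val c) * p.val b / 2)
    (wb := p.val b * (1 - p.val b) / 2)
    (wc := p.val c + (p.val a + p.val b) * p.val b / 2) (wd := 0)
    (by positivity) (div_nonneg (mul_nonneg hb (by linarith)) zero_le_two) (by positivity)
    le_rfl (by rw [hec]; ring)
  have gain : rankGain c a b d q.val p.val = p.val b * (p.val a + p.val b) := by
    rw [rankGain, qa, qb, qc, qd, hd0, hec]; ring
  refine hp ⟨q, fun i => ?_, i, ?_⟩
  · rcases hR i with h | h | h | h <;> rw [h, PCge_ranking_iff hn (by grind) q0 h0]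
    · apply le_of_eq
      rw [rankGain, qa, qb, qc, qd, hd0, hec]; ring
    · rw [gain]; positivity
    · have : rankGain d c a b q.val p.val = p.val b * (p.val a + p.val b) := by
        rw [rankGain, qa, qb, qc, qd, hd0, hec]; ring
      rw [this]; positivity
    · apply le_of_eq
      rw [rankGain, qa, qb, qc, qd, hd0, hec]; ring
  · rw [hi, PCgt_ranking_iff hn (by grind) q0 h0, gain]
    positivity

/-! ### Profiles with two pivotal voters -/

/-- The voters in `I` report `a ≻ b ≻ c ≻ d`, voters `k` and `l` report `r` and `s`, and all other
voters report `d ≻ c ≻ b ≻ a`. -/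
def pivotProfile (I : Finset N) (k l : N) (a b c d : A) (r s : Pref A) : N → Pref A := fun i =>
  if i ∈ I then ranking a b c d else if i = k then r else if i = l then s else ranking d c b a

section Pivot

variable {I : Finset N} {k l : N} {a b c d : A}

lemma pivotProfile_mem (r s : Pref A) :
    ∀ i ∈ I, pivotProfile I k l a b c d r s i = ranking a b c d := by
  intro i hi
  simp [pivotProfile, hi]

lemma pivotProfile_notMem (r s : Pref A) (i : N) (hi : i ∉ I) :
    pivotProfile I k l a b c d r s i = r ∨ pivotProfile I k l a b c d r s i = s ∨
      pivotProfile I k l a b c d r s i = ranking d c b a := by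
  unfold pivotProfile
  split_ifs <;> simp

lemma pivotProfile_left (hk : k ∉ I) (r s : Pref A) :
    pivotProfile I k l a b c d r s k = r := by
  simp [pivotProfile, hk]

lemma pivotProfile_right (hl : l ∉ I) (hkl : k ≠ l) (r s : Pref A) :
    pivotProfile I k l a b c d r s l = s := by
  simp [pivotProfile, hl, hkl.symm]

lemma update_pivotProfile_left (hk : k ∉ I) (r s r' : Pref A) :
    Function.update (pivotProfile I k l a b c d r s) k r' = pivotProfile I k l a b c d r' s := by
  funext i
  simp only [Function.update_apply, pivotProfile]
  split_ifs <;> simp_all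

lemma update_pivotProfile_right (hl : l ∉ I) (hkl : k ≠ l) (r s s' : Pref A) :
    Function.update (pivotProfile I k l a b c d r s) l s' = pivotProfile I k l a b c d r s' := by
  funext i
  simp only [Function.update_apply, pivotProfile]
  split_ifs <;> simp_all

lemma pivotProfile_outside (heff : ∀ R : N → Pref A, PCEfficientLottery R (f R)) [Nonempty N]
    {r s : Pref A}
    (hr : ∃ x y z w, r = ranking x y z w ∧ [x, y, z, w].Perm [a, b, c, d])
    (hs : ∃ x y z w, s = ranking x y z w ∧ [x, y, z, w].Perm [a, b, c, d]) :
    ∀ y ∉ [a, b, c, d], (f (pivotProfile I k l a b c d r s)).val y = 0 := by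
  refine (heff _).eq_zero_of_notMem fun i => ?_
  by_cases hi : i ∈ I
  · exact ⟨_, _, _, _, pivotProfile_mem r s i hi, by grind⟩
  · rcases pivotProfile_notMem (k := k) (l := l) (a := a) (b := b) (c := c) (d := d) r s i hi
      with h | h | h <;> rw [h]
    · exact hr
    · exact hs
    · exact ⟨_, _, _, _, rfl, by grind⟩

end Pivot

/-! ### Outcomes at polarized profiles -/

/-- The probability of `a` when the voters in `I` report `a ≻ x ≻ ⋯` and all other voters report
`x ≻ a ≻ ⋯`. -/
def splitProb (f : (N → Pref A) → Lottery A) (I : Finset N) (a x : A) : ℝ :=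
  (f fun i => if i ∈ I then ranking a x x x else ranking x a a a).val a

lemma splitProb_le_one (I : Finset N) (a x : A) : splitProb f I a x ≤ 1 := by
  simpa [splitProb] using (f _).sum_le_one {a}

lemma splitProb_nonneg (I : Finset N) (a x : A) : 0 ≤ splitProb f I a x :=
  (f _).2.1 a

lemma ranking_pair_val {a x u y : A} (hu : u = a ∨ u = x) (hya : y ≠ a) (hyx : y ≠ x) :
    (ranking a x x x).val u y :=
  ranking_val_of_mem (by rcases hu with rfl | rfl <;> simp) (by simp [hya, hyx])

variable [Fintype N]

lemma eq_splitProb [Nonempty N] (hsp : PCStrategyproof f)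
    (heff : ∀ R : N → Pref A, PCEfficientLottery R (f R)) {I : Finset N} {a x u : A}
    (hax : a ≠ x) (hu : u = a ∨ u = x) {R : N → Pref A} (hR : ∀ i, (R i).val a x ↔ i ∈ I)
    (h : ∀ i y, y ≠ a → y ≠ x → (R i).val u y) : (f R).val a = splitProb f I a x := by
  refine hsp.eq_of_pair hax
    (C := fun i r => (r.val a x ↔ i ∈ I) ∧ ∀ y, y ≠ a → y ≠ x → r.val u y) ?_ ?_ ?_ ?_
  · intro R hR y hya hyx
    exact (heff R).eq_zero_of_pareto fun i => (hR i).2 y hya hyx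
  · intro i r r' hr hr'
    rw [hr.1, hr'.1]
  · exact fun i => ⟨hR i, h i⟩
  · intro i
    by_cases hi : i ∈ I
    · simp only [hi, if_true, iff_true]
      exact ⟨ranking_first a x x x x hax.symm, fun y => ranking_pair_val hu⟩
    · simp only [hi, if_false, iff_false]
      exact ⟨pref_asymm _ (ranking_first x a a a a hax),
        fun y hya hyx => ranking_pair_val hu.symm hyx hya⟩

/-- The outcome when `I` reports `abcd` and the other voters report `bcda` or `dcba`. -/
lemma outcome_bcda (hsp : PCStrategyproof f)
    (heff : ∀ R : N → Pref A, PCEfficientLottery R (f R)) (hawp : AbsoluteWinnerProperty f)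
    {I : Finset N} (hI : I.Nonempty) (hle : 2 * I.card ≤ Fintype.card N)
    (hlt : Fintype.card N < 2 * (I.card + 1)) {a b c d : A} (hn : [a, b, c, d].Nodup)
    {R : N → Pref A} (hRI : ∀ i ∈ I, R i = ranking a b c d)
    (hRK : ∀ i ∉ I, R i = ranking b c d a ∨ R i = ranking d c b a) {k : N} (hk : k ∉ I)
    (hRk : R k = ranking b c d a) :
    (f R).val a = splitProb f I a b ∧ (f R).val b = 1 - splitProb f I a b ∧ (f R).val c = 0 ∧
      (f R).val d = 0 := by
  have hN : Nonempty N := ⟨k⟩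
  have hv := ranking_val_iff hn
  have hn₁ : [b, c, d, a].Nodup := (List.Perm.nodup_iff (by grind)).2 hn
  have hn₂ : [d, c, b, a].Nodup := (List.Perm.nodup_iff (by grind)).2 hn
  have hv₁ := ranking_val_iff hn₁
  have hv₂ := ranking_val_iff hn₂
  have hne : a ≠ b ∧ a ≠ c ∧ a ≠ d ∧ b ≠ c ∧ b ≠ d ∧ c ≠ d := by
    simp at hn; tauto
  obtain ⟨hab, hac, had, hbc, hbd, hcd⟩ := hne
  have outside : ∀ R : N → Pref A, (∀ i, R i = ranking a b c d ∨ R i = ranking b c d a ∨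
      R i = ranking d c b a) → ∀ y ∉ [a, b, c, d], (f R).val y = 0 := by
    intro R hR
    refine (heff R).eq_zero_of_notMem fun i => ?_
    rcases hR i with h | h | h <;> exact ⟨_, _, _, _, h, by grind⟩
  have zero : ∀ R : N → Pref A, (∀ i ∈ I, R i = ranking a b c d) →
      (∀ i ∉ I, R i = ranking b c d a ∨ R i = ranking d c b a) → R k = ranking b c d a →
      (f R).val c = 0 ∧ (f R).val d = 0 := by
    intro R hRI hRK hRk
    have hR : ∀ i, R i = ranking a b c d ∨ R i = ranking b c d a ∨ R i = ranking d c b a := by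
      grind
    refine (heff R).eq_zero_of_bcda hn (outside R hR) hR ⟨k, hRk⟩ ?_
    obtain ⟨j, hj⟩ := hI
    have h1 : (f (Function.update R j (ranking b b b b))).val b = 1 := by
      have c1 := card_erase_add_one hj
      have c2 := card_erase_add_one (mem_compl.2 hk)
      have c3 := card_add_card_compl I
      refine eq_one_of_two_minorities hsp heff hawp (x := b) (U := {a}) (V := {d, c})
        (by simp [*]) (by simp [*, Ne.symm]) (by simp [*]) _ (I.erase j) (Iᶜ.erase k) (by omega)
        (by omega) (fun i => ?_) ⟨j, ?_⟩
      · by_cases hij : i = j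
        · subst hij
          rw [Function.update_self]
          exact Or.inr (Or.inr (ranking_first b b b b))
        · rw [Function.update_of_ne hij]
          by_cases hi : i ∈ I
          · left
            simp [hij, hi, hRI i hi, (hv _).2.1]
          · right
            by_cases hik : i = k
            · right
              rw [hik, hRk]
              exact ranking_first _ _ _ _
            · rcases hRK i hi with h | h
              · right
                rw [h]
                exact ranking_first _ _ _ _
              · left
                simp [hik, hi, h, (hv₂ _).2.2.1]
      · rw [Function.update_self]
        exact ranking_first b b b b
    have h2 := hsp.update R j (ranking b b b b)
    rw [Lottery.eq_point h1, PCge_of_point_iff _ _ (U := {a}) (by simp [hRI j hj, (hv _).2.1]),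
      sum_singleton] at h2
    have := Lottery.sum_eq_one hn (outside R hR)
    linarith
  have hzero := zero R hRI hRK hRk
  have hsum := Lottery.sum_eq_one hn (outside R (by grind))
  have key : (f R).val a = splitProb f I a b := by
    rw [← eq_splitProb hsp heff (u := b) (I := I) hab (Or.inr rfl)
      (R := fun i => if i ∈ I then ranking a b c d else ranking b c d a)]
    · refine hsp.eq_of_pair hab (C := fun i r => (i ∈ I → r = ranking a b c d) ∧
        (i ∉ I → r = ranking b c d a ∨ r = ranking d c b a) ∧ (i = k → r = ranking b c d a))
        ?_ ?_ ?_ ?_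
      · intro R hR y hya hyb
        have hz := zero R (fun i => (hR i).1) (fun i => (hR i).2.1) ((hR k).2.2 rfl)
        by_cases hy : y ∈ [a, b, c, d]
        · grind
        · exact outside R (by grind) y hy
      · intro i r r' hr hr'
        by_cases hi : i ∈ I
        · rw [hr.1 hi, hr'.1 hi]
        · have : ∀ r, r = ranking b c d a ∨ r = ranking d c b a → ¬ r.val a b := by
            rintro r (rfl | rfl)
            · simp [(hv₁ _).1]
            · simp [(hv₂ _).2.2.1, *]
          exact iff_of_false (this r (hr.2.1 hi)) (this r' (hr'.2.1 hi))
      · grind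
      · grind
    · intro i
      by_cases hi : i ∈ I
      · simp [hi, (hv _).2.1]
      · simp [hi, (hv₁ _).1]
    · intro i y hya hyb
      have : ∀ r, r = ranking a b c d ∨ r = ranking b c d a → r.val b y := by
        rintro r (rfl | rfl)
        · have := hv y
          have := hv b
          grind
        · exact ranking_first _ _ _ _ _ hyb
      apply this
      split_ifs <;> simp
  exact ⟨key, by linarith, hzero.1, hzero.2⟩

/-- The outcome when `I` reports `abcd` and the other voters report `dabc` or `dcba`. -/
lemma outcome_dabc (hsp : PCStrategyproof f)
    (heff : ∀ R : N → Pref A, PCEfficientLottery R (f R)) {I : Finset N} {a b c d : A}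
    (hn : [a, b, c, d].Nodup) {R : N → Pref A} (hRI : ∀ i ∈ I, R i = ranking a b c d)
    (hRK : ∀ i ∉ I, R i = ranking d a b c ∨ R i = ranking d c b a) {k : N} (hk : k ∉ I)
    (hRk : R k = ranking d a b c) :
    (f R).val a = splitProb f I a d ∧ (f R).val b = 0 ∧ (f R).val c = 0 ∧
      (f R).val d = 1 - splitProb f I a d := by
  have hN : Nonempty N := ⟨k⟩
  have hv := ranking_val_iff hn
  have hv₁ := ranking_val_iff ((List.Perm.nodup_iff (by grind)).2 hn : [d, a, b, c].Nodup)
  have hv₂ := ranking_val_iff ((List.Perm.nodup_iff (by grind)).2 hn : [d, c, b, a].Nodup)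
  have had : a ≠ d := by
    simp at hn; tauto
  have zero : ∀ R : N → Pref A, (∀ i, R i = ranking a b c d ∨ R i = ranking d a b c ∨
      R i = ranking d c b a) → R k = ranking d a b c →
      (∀ y ∉ [a, b, c, d], (f R).val y = 0) ∧ (f R).val b = 0 ∧ (f R).val c = 0 := by
    intro R hR hRk
    have outside : ∀ y ∉ [a, b, c, d], (f R).val y = 0 := by
      refine (heff R).eq_zero_of_notMem fun i => ?_
      rcases hR i with h | h | h <;> exact ⟨_, _, _, _, h, by grind⟩
    exact ⟨outside, (heff R).eq_zero_of_dabc hn outside hR ⟨k, hRk⟩⟩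
  obtain ⟨outside, hb0, hc0⟩ := zero R (by grind) hRk
  have hsum := Lottery.sum_eq_one hn outside
  have key : (f R).val a = splitProb f I a d := by
    rw [← eq_splitProb hsp heff (u := a) (I := I) had (Or.inl rfl)
      (R := fun i => if i ∈ I then ranking a b c d else ranking d a b c)]
    · refine hsp.eq_of_pair had (C := fun i r => (i ∈ I → r = ranking a b c d) ∧
        (i ∉ I → r = ranking d a b c ∨ r = ranking d c b a) ∧ (i = k → r = ranking d a b c))
        ?_ ?_ ?_ ?_
      · intro R hR y hya hyd
        have hz := zero R (by grind) ((hR k).2.2 rfl)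
        by_cases hy : y ∈ [a, b, c, d]
        · grind
        · exact hz.1 y hy
      · intro i r r' hr hr'
        by_cases hi : i ∈ I
        · rw [hr.1 hi, hr'.1 hi]
        · have : ∀ r, r = ranking d a b c ∨ r = ranking d c b a → ¬ r.val a d := by
            rintro r (rfl | rfl)
            · simp [(hv₁ _).1]
            · simp [(hv₂ _).1]
          exact iff_of_false (this r (hr.2.1 hi)) (this r' (hr'.2.1 hi))
      · grind
      · grind
    · intro i
      by_cases hi : i ∈ I
      · simp [hi, (hv _).2.2.2.1]
      · simp [hi, (hv₁ _).1]
    · intro i y hya hyd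
      have : ∀ r, r = ranking a b c d ∨ r = ranking d a b c → r.val a y := by
        rintro r (rfl | rfl)
        · exact ranking_first _ _ _ _ _ hya
        · have := hv₁ y
          have := hv₁ a
          grind
      apply this
      split_ifs <;> simp
  exact ⟨key, hb0, hc0, by linarith⟩

/-- The outcome when `I` reports `abcd` and the other voters report `cabd`, `dcab` or `dcba`. -/
lemma outcome_cabd (hsp : PCStrategyproof f)
    (heff : ∀ R : N → Pref A, PCEfficientLottery R (f R)) (hawp : AbsoluteWinnerProperty f)
    {I : Finset N} (hI : I.Nonempty) (hle : 2 * I.card ≤ Fintype.card N)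
    (hlt : Fintype.card N < 2 * (I.card + 1)) {a b c d : A} (hn : [a, b, c, d].Nodup)
    {R : N → Pref A} (hRI : ∀ i ∈ I, R i = ranking a b c d)
    (hRK : ∀ i ∉ I, R i = ranking c a b d ∨ R i = ranking d c a b ∨ R i = ranking d c b a)
    {k : N} (hk : k ∉ I) (hRk : R k = ranking c a b d) :
    (f R).val a = splitProb f I a c ∧ (f R).val b = 0 ∧ (f R).val c = 1 - splitProb f I a c ∧
      (f R).val d = 0 := by
  have hN : Nonempty N := ⟨k⟩
  have hv := ranking_val_iff hn
  have hv₁ := ranking_val_iff ((List.Perm.nodup_iff (by grind)).2 hn : [c, a, b, d].Nodup)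
  have hv₂ := ranking_val_iff ((List.Perm.nodup_iff (by grind)).2 hn : [d, c, a, b].Nodup)
  have hv₃ := ranking_val_iff ((List.Perm.nodup_iff (by grind)).2 hn : [d, c, b, a].Nodup)
  have hne : a ≠ b ∧ a ≠ c ∧ a ≠ d ∧ b ≠ c ∧ b ≠ d ∧ c ≠ d := by
    simp at hn; tauto
  obtain ⟨hab, hac, had, hbc, hbd, hcd⟩ := hne
  have outside : ∀ R : N → Pref A, (∀ i, R i = ranking a b c d ∨ R i = ranking c a b d ∨
      R i = ranking d c a b ∨ R i = ranking d c b a) → ∀ y ∉ [a, b, c, d], (f R).val y = 0 := by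
    intro R hR
    refine (heff R).eq_zero_of_notMem fun i => ?_
    rcases hR i with h | h | h | h <;> exact ⟨_, _, _, _, h, by grind⟩
  have zero : ∀ R : N → Pref A, (∀ i ∈ I, R i = ranking a b c d) →
      (∀ i ∉ I, R i = ranking c a b d ∨ R i = ranking d c a b ∨ R i = ranking d c b a) →
      R k = ranking c a b d → (f R).val b = 0 ∧ (f R).val d = 0 := by
    intro R hRI hRK hRk
    have hR : ∀ i, R i = ranking a b c d ∨ R i = ranking c a b d ∨ R i = ranking d c a b ∨
        R i = ranking d c b a := by
      grind
    refine (heff R).eq_zero_of_cabd hn (outside R hR) hR ⟨k, hRk⟩ ?_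
    obtain ⟨j, hj⟩ := hI
    have h1 : (f (Function.update R j (ranking c c c c))).val c = 1 := by
      have c1 := card_erase_add_one hj
      have c2 := card_erase_add_one (mem_compl.2 hk)
      have c3 := card_add_card_compl I
      refine eq_one_of_two_minorities hsp heff hawp (x := c) (U := {a, b}) (V := {d})
        (by simp [had.symm, hbd.symm]) (by simp [*, Ne.symm]) (by simp [*]) _ (I.erase j) (Iᶜ.erase k) (by omega)
        (by omega) (fun i => ?_) ⟨j, ?_⟩
      · by_cases hij : i = j
        · subst hij
          rw [Function.update_self]
          exact Or.inr (Or.inr (ranking_first c c c c))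
        · rw [Function.update_of_ne hij]
          by_cases hi : i ∈ I
          · left
            simp [hij, hi, hRI i hi, (hv _).2.2.1]
          · right
            by_cases hik : i = k
            · right
              rw [hik, hRk]
              exact ranking_first _ _ _ _
            · rcases hRK i hi with h | h | h
              · right
                rw [h]
                exact ranking_first _ _ _ _
              · left
                simp [hik, hi, h, (hv₂ _).2.1]
              · left
                simp [hik, hi, h, (hv₃ _).2.1]
      · rw [Function.update_self]
        exact ranking_first c c c c
    have h2 := hsp.update R j (ranking c c c c)
    rw [Lottery.eq_point h1, PCge_of_point_iff _ _ (U := {a, b})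
      (by simp [hRI j hj, (hv _).2.2.1]), sum_pair hab] at h2
    have := Lottery.sum_eq_one hn (outside R hR)
    linarith
  have hzero := zero R hRI hRK hRk
  have hsum := Lottery.sum_eq_one hn (outside R (by grind))
  have key : (f R).val a = splitProb f I a c := by
    rw [← eq_splitProb hsp heff (u := a) (I := I) hac (Or.inl rfl)
      (R := fun i => if i ∈ I then ranking a b c d else ranking c a b d)]
    · refine hsp.eq_of_pair hac (C := fun i r => (i ∈ I → r = ranking a b c d) ∧
        (i ∉ I → r = ranking c a b d ∨ r = ranking d c a b ∨ r = ranking d c b a) ∧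
        (i = k → r = ranking c a b d)) ?_ ?_ ?_ ?_
      · intro R hR y hya hyb
        have hz := zero R (fun i => (hR i).1) (fun i => (hR i).2.1) ((hR k).2.2 rfl)
        by_cases hy : y ∈ [a, b, c, d]
        · grind
        · exact outside R (by grind) y hy
      · intro i r r' hr hr'
        by_cases hi : i ∈ I
        · rw [hr.1 hi, hr'.1 hi]
        · have : ∀ r, r = ranking c a b d ∨ r = ranking d c a b ∨ r = ranking d c b a →
              ¬ r.val a c := by
            rintro r (rfl | rfl | rfl)
            · simp [(hv₁ _).1]
            · simp [(hv₂ _).2.1, *]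
            · simp [(hv₃ _).2.1, *]
          exact iff_of_false (this r (hr.2.1 hi)) (this r' (hr'.2.1 hi))
      · grind
      · grind
    · intro i
      by_cases hi : i ∈ I
      · simp [hi, (hv _).2.2.1]
      · simp [hi, (hv₁ _).1]
    · intro i y hya hyc
      have : ∀ r, r = ranking a b c d ∨ r = ranking c a b d → r.val a y := by
        rintro r (rfl | rfl)
        · exact ranking_first _ _ _ _ _ hya
        · have := hv₁ y
          have := hv₁ a
          grind
      apply this
      split_ifs <;> simp
  exact ⟨key, hzero.1, by linarith, hzero.2⟩

/-! ### Manipulations by the pivotal voters -/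

lemma AbsoluteWinnerProperty.pivotProfile_eq_one {I : Finset N} {k l : N} {a b c d : A}
    (hawp : AbsoluteWinnerProperty f) (hl : l ∉ I)
    (hkl : k ≠ l) (hlt : Fintype.card N < 2 * (I.card + 1)) (r : Pref A) :
    (f (pivotProfile I k l a b c d r (ranking a b c d))).val a = 1 := by
  have c1 := card_erase_add_one (mem_compl.2 hl)
  have c2 := card_add_card_compl I
  refine hawp.eq_one (Q := Iᶜ.erase l) (by omega) fun i hi => ?_
  by_cases hil : i = l
  · rw [hil, pivotProfile_right hl hkl]
    exact ranking_first _ _ _ _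
  · rw [pivotProfile_mem _ _ i (by simpa [hil] using hi)]
    exact ranking_first _ _ _ _

lemma pivot_bcda_dabc (hsp : PCStrategyproof f)
    (heff : ∀ R : N → Pref A, PCEfficientLottery R (f R)) (hawp : AbsoluteWinnerProperty f)
    {I : Finset N} {k l : N} (hI : I.Nonempty) (hle : 2 * I.card ≤ Fintype.card N)
    (hlt : Fintype.card N < 2 * (I.card + 1)) (hk : k ∉ I) (hl : l ∉ I) (hkl : k ≠ l)
    {a b c d : A} (hn : [a, b, c, d].Nodup) {p : Lottery A}
    (hp : p = f (pivotProfile I k l a b c d (ranking b c d a) (ranking d a b c))) :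
    p.val b + p.val c ≤ p.val d ∧
      p.val c + p.val d + splitProb f I a b * p.val b ≤ (1 - splitProb f I a b) * p.val a ∧
      (1 - splitProb f I a d) * p.val a ≤ p.val b + p.val c + splitProb f I a d * p.val d := by
  have hN : Nonempty N := ⟨k⟩
  have out := fun {r s : Pref A} => pivotProfile_outside (f := f) heff (I := I) (k := k) (l := l)
    (a := a) (b := b) (c := c) (d := d) (r := r) (s := s)
  have hp0 : ∀ y ∉ [a, b, c, d], p.val y = 0 :=
    hp ▸ out ⟨_, _, _, _, rfl, by grind⟩ ⟨_, _, _, _, rfl, by grind⟩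
  have hv := ranking_val_iff ((List.Perm.nodup_iff (by grind)).2 hn : [d, a, b, c].Nodup)
  refine ⟨?_, ?_, ?_⟩
  · have h := hsp.update (pivotProfile I k l a b c d (ranking b c d a) (ranking d a b c)) l
      (ranking a b c d)
    rw [update_pivotProfile_right hl hkl, pivotProfile_right hl hkl,
      Lottery.eq_point (hawp.pivotProfile_eq_one hl hkl hlt _), ← hp,
      PCge_of_point_iff _ _ (U := {d}) (by simp [(hv _).2.1]), sum_singleton] at h
    have := Lottery.sum_eq_one hn hp0
    linarith
  · have h := hsp.update (pivotProfile I k l a b c d (ranking b c d a) (ranking d c b a)) l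
      (ranking d a b c)
    rw [update_pivotProfile_right hl hkl, pivotProfile_right hl hkl, ← hp,
      PCge_ranking_iff hn (by grind)
        (out ⟨_, _, _, _, rfl, by grind⟩ ⟨_, _, _, _, rfl, by grind⟩) hp0] at h
    obtain ⟨ea, eb, ec, ed⟩ := outcome_bcda hsp heff hawp hI hle hlt hn
      (pivotProfile_mem (k := k) (l := l) (ranking b c d a) (ranking d c b a))
      (fun i hi => by unfold pivotProfile; split_ifs <;> simp) hk (pivotProfile_left hk _ _)
    rw [rankGain, ea, eb, ec, ed] at h
    linarith
  · have h := hsp.update (pivotProfile I k l a b c d (ranking b c d a) (ranking d a b c)) k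
      (ranking d a b c)
    rw [update_pivotProfile_left hk, pivotProfile_left hk, ← hp,
      PCge_ranking_iff hn (by grind) hp0
        (out ⟨_, _, _, _, rfl, by grind⟩ ⟨_, _, _, _, rfl, by grind⟩)] at h
    obtain ⟨ea, eb, ec, ed⟩ := outcome_dabc hsp heff hn
      (pivotProfile_mem (I := I) (k := k) (l := l) (ranking d a b c) (ranking d a b c))
      (fun i hi => by unfold pivotProfile; split_ifs <;> simp) hk (pivotProfile_left hk _ _)
    rw [rankGain, ea, eb, ec, ed] at h
    linarith

lemma pivot_bcda_dcab (hsp : PCStrategyproof f)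
    (heff : ∀ R : N → Pref A, PCEfficientLottery R (f R)) (hawp : AbsoluteWinnerProperty f)
    {I : Finset N} {k l : N} (hI : I.Nonempty) (hle : 2 * I.card ≤ Fintype.card N)
    (hlt : Fintype.card N < 2 * (I.card + 1)) (hk : k ∉ I) (hl : l ∉ I) (hkl : k ≠ l)
    {a b c d : A} (hn : [a, b, c, d].Nodup) {p : Lottery A}
    (hp : p = f (pivotProfile I k l a b c d (ranking b c d a) (ranking d c a b))) :
    p.val b ≤ p.val c + p.val d ∧
      p.val c + p.val d + splitProb f I a b * p.val b ≤ (1 - splitProb f I a b) * p.val a ∧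
      (1 - splitProb f I a c) * p.val a ≤ p.val b + splitProb f I a c * p.val c +
        (2 * splitProb f I a c - 1) * p.val d := by
  have hN : Nonempty N := ⟨k⟩
  have out := fun {r s : Pref A} => pivotProfile_outside (f := f) heff (I := I) (k := k) (l := l)
    (a := a) (b := b) (c := c) (d := d) (r := r) (s := s)
  have hp0 : ∀ y ∉ [a, b, c, d], p.val y = 0 :=
    hp ▸ out ⟨_, _, _, _, rfl, by grind⟩ ⟨_, _, _, _, rfl, by grind⟩
  have hv := ranking_val_iff ((List.Perm.nodup_iff (by grind)).2 hn : [d, c, a, b].Nodup)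
  have hcd : c ≠ d := by
    simp at hn; tauto
  refine ⟨?_, ?_, ?_⟩
  · have h := hsp.update (pivotProfile I k l a b c d (ranking b c d a) (ranking d c a b)) l
      (ranking a b c d)
    rw [update_pivotProfile_right hl hkl, pivotProfile_right hl hkl,
      Lottery.eq_point (hawp.pivotProfile_eq_one hl hkl hlt _), ← hp,
      PCge_of_point_iff _ _ (U := {d, c}) (by simp [(hv _).2.2.1]), sum_pair hcd.symm] at h
    have := Lottery.sum_eq_one hn hp0
    linarith
  · have h := hsp.update (pivotProfile I k l a b c d (ranking b c d a) (ranking d c b a)) l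
      (ranking d c a b)
    rw [update_pivotProfile_right hl hkl, pivotProfile_right hl hkl, ← hp,
      PCge_ranking_iff hn (by grind)
        (out ⟨_, _, _, _, rfl, by grind⟩ ⟨_, _, _, _, rfl, by grind⟩) hp0] at h
    obtain ⟨ea, eb, ec, ed⟩ := outcome_bcda hsp heff hawp hI hle hlt hn
      (pivotProfile_mem (k := k) (l := l) (ranking b c d a) (ranking d c b a))
      (fun i hi => by unfold pivotProfile; split_ifs <;> simp) hk (pivotProfile_left hk _ _)
    rw [rankGain, ea, eb, ec, ed] at h
    linarith
  · have h := hsp.update (pivotProfile I k l a b c d (ranking b c d a) (ranking d c a b)) k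
      (ranking c a b d)
    rw [update_pivotProfile_left hk, pivotProfile_left hk, ← hp,
      PCge_ranking_iff hn (by grind) hp0
        (out ⟨_, _, _, _, rfl, by grind⟩ ⟨_, _, _, _, rfl, by grind⟩)] at h
    obtain ⟨ea, eb, ec, ed⟩ := outcome_cabd hsp heff hawp hI hle hlt hn
      (pivotProfile_mem (k := k) (l := l) (ranking c a b d) (ranking d c a b))
      (fun i hi => pivotProfile_notMem _ _ i hi) hk (pivotProfile_left hk _ _)
    rw [rankGain, ea, eb, ec, ed] at h
    linarith

lemma splitProb_le (hsp : PCStrategyproof f)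
    (heff : ∀ R : N → Pref A, PCEfficientLottery R (f R)) (hawp : AbsoluteWinnerProperty f)
    {I : Finset N} {k l : N} (hI : I.Nonempty) (hle : 2 * I.card ≤ Fintype.card N)
    (hlt : Fintype.card N < 2 * (I.card + 1)) (hk : k ∉ I) (hl : l ∉ I) (hkl : k ≠ l)
    {a b c d : A} (hn : [a, b, c, d].Nodup) : splitProb f I a b ≤ splitProb f I a d := by
  have hN : Nonempty N := ⟨k⟩
  obtain ⟨p, hp⟩ : ∃ p, p = f (pivotProfile I k l a b c d (ranking b c d a) (ranking d a b c)) :=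
    ⟨_, rfl⟩
  obtain ⟨h1, h2, h3⟩ := pivot_bcda_dabc hsp heff hawp hI hle hlt hk hl hkl hn hp
  have hsum := Lottery.sum_eq_one (p := p) hn
    (hp ▸ pivotProfile_outside heff ⟨_, _, _, _, rfl, by grind⟩ ⟨_, _, _, _, rfl, by grind⟩)
  have ha := p.2.1 a
  have hb := p.2.1 b
  have hc := p.2.1 c
  have hd := p.2.1 d
  have ht := splitProb_le_one (f := f) I a b
  have hw := splitProb_nonneg (f := f) I a d
  have ht0 := splitProb_nonneg (f := f) I a b
  have hw1 := splitProb_le_one (f := f) I a d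
  generalize splitProb f I a b = t at *
  generalize splitProb f I a d = w at *
  by_contra! hlt'
  have h4 : (t - w) * (p.val a + p.val b) ≤ 0 := by nlinarith
  have h5 : p.val a + p.val b ≤ 0 := by
    by_contra! h
    nlinarith
  have ha0 : p.val a = 0 := by linarith
  have hb0 : p.val b = 0 := by linarith
  rw [ha0, hb0] at h2
  linarith

/-- The half `I` of the electorate enforces `a` against `b`. -/
lemma splitProb_eq_one (hsp : PCStrategyproof f)
    (heff : ∀ R : N → Pref A, PCEfficientLottery R (f R)) (hawp : AbsoluteWinnerProperty f)
    {I : Finset N} {k l : N} (hI : I.Nonempty) (hle : 2 * I.card ≤ Fintype.card N)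
    (hlt : Fintype.card N < 2 * (I.card + 1)) (hk : k ∉ I) (hl : l ∉ I) (hkl : k ≠ l)
    {a b c d : A} (hn : [a, b, c, d].Nodup) : splitProb f I a b = 1 := by
  have hN : Nonempty N := ⟨k⟩
  have mono := fun {a b c d : A} => splitProb_le (a := a) (b := b) (c := c) (d := d) hsp heff hawp
    hI hle hlt hk hl hkl
  have hbd : splitProb f I a d = splitProb f I a b :=
    le_antisymm (mono (c := c) ((List.Perm.nodup_iff (by grind)).2 hn)) (mono hn)
  have hbc : splitProb f I a c = splitProb f I a b :=
    le_antisymm (mono (c := d) ((List.Perm.nodup_iff (by grind)).2 hn))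
      (mono (c := d) ((List.Perm.nodup_iff (by grind)).2 hn))
  by_contra hne
  have ht : splitProb f I a b < 1 := lt_of_le_of_ne (splitProb_le_one I a b) hne
  have ht0 := splitProb_nonneg (f := f) I a b
  obtain ⟨p, hp⟩ : ∃ p, p = f (pivotProfile I k l a b c d (ranking b c d a) (ranking d a b c)) :=
    ⟨_, rfl⟩
  obtain ⟨q, hq⟩ : ∃ q, q = f (pivotProfile I k l a b c d (ranking b c d a) (ranking d c a b)) :=
    ⟨_, rfl⟩
  obtain ⟨p1, p2, p3⟩ := pivot_bcda_dabc hsp heff hawp hI hle hlt hk hl hkl hn hp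
  obtain ⟨q1, q2, q3⟩ := pivot_bcda_dcab hsp heff hawp hI hle hlt hk hl hkl hn hq
  have hp0 : ∀ y ∉ [a, b, c, d], p.val y = 0 :=
    hp ▸ pivotProfile_outside heff ⟨_, _, _, _, rfl, by grind⟩ ⟨_, _, _, _, rfl, by grind⟩
  have hq0 : ∀ y ∉ [a, b, c, d], q.val y = 0 :=
    hq ▸ pivotProfile_outside heff ⟨_, _, _, _, rfl, by grind⟩ ⟨_, _, _, _, rfl, by grind⟩
  have hgain := hsp.update (pivotProfile I k l a b c d (ranking b c d a) (ranking d c a b)) l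
    (ranking d a b c)
  rw [update_pivotProfile_right hl hkl, pivotProfile_right hl hkl, ← hp, ← hq,
    PCge_ranking_iff hn (by grind) hq0 hp0, rankGain] at hgain
  have hps := Lottery.sum_eq_one hn hp0
  have hqs := Lottery.sum_eq_one hn hq0
  have pc := p.2.1 c
  have qd := q.2.1 d
  rw [hbd] at p3
  rw [hbc] at q3
  generalize splitProb f I a b = t at *
  have e1 : p.val d ≤ p.val b := by
    have : (1 - t) * p.val d ≤ (1 - t) * p.val b := by linarith
    exact le_of_mul_le_mul_left this (by linarith)
  have e2 : p.val c = 0 := by linarith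
  have e3 : p.val d = p.val b := by linarith
  have e4 : q.val c + 2 * q.val d ≤ q.val b := by
    have : (1 - t) * (q.val c + 2 * q.val d) ≤ (1 - t) * q.val b := by linarith
    exact le_of_mul_le_mul_left this (by linarith)
  have e5 : q.val d = 0 := by linarith
  have e6 : q.val c = q.val b := by linarith
  rw [e2, e3] at p2 p3 hps
  rw [e5, e6] at q2 q3 hqs
  have hpb : (3 - t) * p.val b = 1 - t := by nlinarith
  have hqb : (3 - t) * q.val b = 1 - t := by nlinarith
  have hpos : 0 < p.val b := by
    by_contra! h
    nlinarith
  have hb : q.val b = p.val b := mul_left_cancel₀ (by linarith : (3 - t) ≠ 0) (hqb.trans hpb.symm)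
  have ha : q.val a = p.val a := by linarith
  rw [e2, e3, e5, e6, ha, hb] at hgain
  nlinarith

end SDS

/-- For `m ≥ 4` alternatives and a finite electorate with `|N| ≥ 3`,
`|N| ∉ {4,6}`, every PC-efficient SDS satisfying the absolute winner property is
PC-manipulable. -/
theorem pc_efficient_absolute_winner_implies_pc_manipulable
    {A N : Type*} [Fintype A] [Fintype N]
    (hm : 4 ≤ Fintype.card A) (hn : 3 ≤ Fintype.card N)
    (hn4 : Fintype.card N ≠ 4) (hn6 : Fintype.card N ≠ 6)
    (f : (N → Pref A) → Lottery A)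
    (heff : ∀ R : N → Pref A, PCEfficientLottery R (f R))
    (hawp : AbsoluteWinnerProperty f) :
    ¬ PCStrategyproof f := by
  intro hsp
  obtain ⟨g⟩ : Nonempty (Fin 4 ↪ A) := Function.Embedding.nonempty_of_card_le (by simpa using hm)
  have hnodup : [g 0, g 1, g 2, g 3].Nodup := by simp
  obtain ⟨I, -, hcard⟩ := exists_subset_card_eq (s := (univ : Finset N))
    (n := Fintype.card N / 2) (by rw [card_univ]; omega)
  have hcompl := card_add_card_compl I
  obtain ⟨k, hk, l, hl, hkl⟩ := one_lt_card.1 (by omega : 1 < Iᶜ.card)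
  have h0 : splitProb f I (g 0) (g 1) = 1 :=
    splitProb_eq_one hsp heff hawp (card_pos.1 (by omega)) (by omega) (by omega) (mem_compl.1 hk)
      (mem_compl.1 hl) hkl hnodup
  have h1 : (f fun i => if i ∈ I then ranking (g 0) (g 1) (g 1) (g 1)
      else ranking (g 1) (g 0) (g 0) (g 0)).val (g 1) = 1 := by
    by_cases hlt : 2 * I.card < Fintype.card N
    · refine hawp.eq_one hlt fun i hi => ?_
      rw [if_neg hi]
      exact ranking_first _ _ _ _
    · obtain ⟨k', hk', l', hl', hkl'⟩ := one_lt_card.1 (by omega : 1 < I.card)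
      have := splitProb_eq_one hsp heff hawp (I := Iᶜ) (card_pos.1 (by omega)) (by omega)
        (by omega) (k := k') (l := l') (by simpa using hk') (by simpa using hl') hkl'
        (a := g 1) (b := g 0) (c := g 2) (d := g 3) (by simp)
      simpa only [splitProb, mem_compl, ite_not] using this
  have h2 := Lottery.eq_point h0
  rw [h2] at h1
  simp [Lottery.point] at h1

end
end

section
/- Let A = {a,b,c,d,e} and let R be the profile on eight voters with preferences: voter 1: b,d,c,a,e; voter 2: a,e,c,b,d; voter 3: d,c,a,b,e; voter 4: e,c,a,b,d; voter 5: b,d,e,c,a; voter 6: a,e,d,c,b; voter 7: b,e,d,c,a; voter 8: a,d,e,c,b. Then for every lottery p with p(a) = p(b) > 0 and p(d) = p(e) = 0, a lottery q PC-dominates p in R if and only if q(a) = q(b) < p(a) = p(b) and q(d) = q(e) = 0. -/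
open scoped Classical
open Finset

noncomputable section

variable {A : Type*} [Fintype A]

/-- The value of `PCsum` for a preference relation listed from best to worst. -/
theorem PCsum_eq_of_chain {A : Type*} [Fintype A] (r : Pref A) {v w x y z : A}
    (h : r.val v w ∧ r.val w x ∧ r.val x y ∧ r.val y z)
    (hcover : ∀ u : A, u = v ∨ u = w ∨ u = x ∨ u = y ∨ u = z) (f g : A → ℝ) :
    PCsum r f g = f v * (g w + g x + g y + g z) + f w * (g x + g y + g z)
      + f x * (g y + g z) + f y * g z := by
  obtain ⟨r, hr⟩ := r
  obtain ⟨hvw, hwx, hxy, hyz⟩ := h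
  dsimp only at hvw hwx hxy hyz
  have hirr : ∀ u, ¬ r u u := fun u => irrefl_of r u
  have htr : ∀ {s t u}, r s t → r t u → r s u := fun h₁ h₂ => trans_of r h₁ h₂
  have hasymm : ∀ {s t}, r s t → ¬ r t s := fun h₁ h₂ => hirr _ (htr h₁ h₂)
  have hne : ∀ {s t}, r s t → s ≠ t := fun h₁ h₂ => hirr _ (h₂ ▸ h₁)
  have hvx := htr hvw hwx
  have hwy := htr hwx hxy
  have hxz := htr hxy hyz
  have hvy := htr hvx hxy
  have hwz := htr hwy hyz
  have hvz := htr hvy hyz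
  have huniv : (Finset.univ : Finset A) = {v, w, x, y, z} := by
    ext u
    simpa using hcover u
  simp only [PCsum, huniv]
  simp [Finset.sum_insert, hne hvw, hne hvx, hne hvy, hne hvz, hne hwx, hne hwy, hne hwz,
    hne hxy, hne hxz, hne hyz, hirr, hvw, hvx, hvy, hvz, hwx, hwy, hwz, hxy, hxz, hyz,
    hasymm hvw, hasymm hvx, hasymm hvy, hasymm hvz, hasymm hwx, hasymm hwy, hasymm hwz,
    hasymm hxy, hasymm hxz, hasymm hyz]
  ring

set_option maxHeartbeats 1000000 in
/-- In the given 8-voter profile over `A = {a,b,c,d,e}`, for every lottery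
`p` with `p(a) = p(b) > 0` and `p(d) = p(e) = 0`, a lottery `q` PC-dominates `p` iff
`q(a) = q(b) < p(a) = p(b)` and `q(d) = q(e) = 0`. -/
theorem pc_dominators_of_half_a_half_b_lotteries
    {A : Type*} [Fintype A]
    (a b c d e : A)
    (hab : a ≠ b) (hac : a ≠ c) (had : a ≠ d) (hae : a ≠ e)
    (hbc : b ≠ c) (hbd : b ≠ d) (hbe : b ≠ e)
    (hcd : c ≠ d) (hce : c ≠ e) (hde : d ≠ e)
    (hcover : ∀ u : A, u = a ∨ u = b ∨ u = c ∨ u = d ∨ u = e)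
    (R : Fin 8 → Pref A)
    (h1 : (R 0).val b d ∧ (R 0).val d c ∧ (R 0).val c a ∧ (R 0).val a e)
    (h2 : (R 1).val a e ∧ (R 1).val e c ∧ (R 1).val c b ∧ (R 1).val b d)
    (h3 : (R 2).val d c ∧ (R 2).val c a ∧ (R 2).val a b ∧ (R 2).val b e)
    (h4 : (R 3).val e c ∧ (R 3).val c a ∧ (R 3).val a b ∧ (R 3).val b d)
    (h5 : (R 4).val b d ∧ (R 4).val d e ∧ (R 4).val e c ∧ (R 4).val c a)
    (h6 : (R 5).val a e ∧ (R 5).val e d ∧ (R 5).val d c ∧ (R 5).val c b)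
    (h7 : (R 6).val b e ∧ (R 6).val e d ∧ (R 6).val d c ∧ (R 6).val c a)
    (h8 : (R 7).val a d ∧ (R 7).val d e ∧ (R 7).val e c ∧ (R 7).val c b)
    (p : Lottery A) (hpab : p.val a = p.val b) (hpa : 0 < p.val a)
    (hpd : p.val d = 0) (hpe : p.val e = 0) :
    ∀ q : Lottery A,
      PCDominates R q p ↔
        (q.val a = q.val b ∧ q.val a < p.val a ∧ q.val d = 0 ∧ q.val e = 0) := by
  intro q
  have huniv : (Finset.univ : Finset A) = {a, b, c, d, e} := by
    ext u
    simpa using hcover u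
  have hsum : ∀ f : A → ℝ, ∑ u, f u = f a + f b + f c + f d + f e := by
    intro f
    rw [huniv]
    simp [Finset.sum_insert, hab, hac, had, hae, hbc, hbd, hbe, hcd, hce, hde]
    ring
  have hp := p.2.2
  have hq := q.2.2
  have hpc_nonneg : 0 ≤ p.val c := p.2.1 c
  have hqd : 0 ≤ q.val d := q.2.1 d
  have hqe : 0 ≤ q.val e := q.2.1 e
  rw [hsum] at hp hq
  change p.val a + p.val b + p.val c + p.val d + p.val e = 1 at hp
  change q.val a + q.val b + q.val c + q.val d + q.val e = 1 at hq
  have hpc : p.val c = 1 - 2 * p.val a := by linarith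
  have ht : p.val a ≤ 1 / 2 := by linarith
  have hqc : q.val c = 1 - q.val a - q.val b - q.val d - q.val e := by linarith
  have s0 := PCsum_eq_of_chain (R 0) h1 (fun u => by have := hcover u; tauto)
  have s1 := PCsum_eq_of_chain (R 1) h2 (fun u => by have := hcover u; tauto)
  have s2 := PCsum_eq_of_chain (R 2) h3 (fun u => by have := hcover u; tauto)
  have s3 := PCsum_eq_of_chain (R 3) h4 (fun u => by have := hcover u; tauto)
  have s4 := PCsum_eq_of_chain (R 4) h5 (fun u => by have := hcover u; tauto)
  have s5 := PCsum_eq_of_chain (R 5) h6 (fun u => by have := hcover u; tauto)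
  have s6 := PCsum_eq_of_chain (R 6) h7 (fun u => by have := hcover u; tauto)
  have s7 := PCsum_eq_of_chain (R 7) h8 (fun u => by have := hcover u; tauto)
  simp only [PCDominates, PCge, PCgt, Fin.forall_fin_succ, Fin.exists_fin_succ]
  simp only [Fin.isValue, Fin.succ_zero_eq_one, Fin.reduceSucc, IsEmpty.forall_iff,
    IsEmpty.exists_iff, and_true, or_false, s0, s1, s2, s3, s4, s5, s6, s7, ← hpab, hpd, hpe,
    hpc, hqc]
  clear s0 s1 s2 s3 s4 s5 s6 s7
  generalize p.val a = t at *
  generalize q.val a = x at *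
  generalize q.val b = y at *
  generalize q.val d = v at *
  generalize q.val e = w at *
  constructor
  · rintro ⟨⟨g0, g1, -⟩, hstrict⟩
    have hvw : t * (v + w) ≤ 0 := by linarith
    have hvw' : v + w ≤ 0 := nonpos_of_mul_nonpos_right hvw hpa
    obtain rfl : v = 0 := by linarith
    obtain rfl : w = 0 := by linarith
    have hxy : x = y := by
      have hmul : (1 - t) * (x - y) = 0 := by linarith
      rcases mul_eq_zero.mp hmul with h | h <;> linarith
    subst hxy
    refine ⟨rfl, ?_, rfl, rfl⟩
    rcases hstrict with h | h | h | h | h | h | h | h <;> linarith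
  · rintro ⟨rfl, hlt, rfl, rfl⟩
    refine ⟨⟨?_, ?_, ?_, ?_, ?_, ?_, ?_, ?_⟩, Or.inr (Or.inr (Or.inl ?_))⟩ <;> linarith

end
end
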